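/- For k = 2 the double integrals satisfy I₁(2) = π(1/2 − log 4) and I₂(2) = π(log 4 − 3/2). -/

import Mathlib

open Real

/-- The double integral `I₁(k)` from Lemma `lemmaI1I2`. -/
noncomputable def I₁ (k : ℤ) : ℝ :=
  ∫ β in (-π)..π, ∫ s in (0 : ℝ)..1,
    β * Real.cos (β * s) / (4 * Real.sin (β / 2) ^ 2) *
      Real.sin (((k : ℝ) - 1) * (s - 1) * β - β)

/-- The double integral `I₂(k)` from Lemma `lemmaI1I2`. -/
noncomputable def I₂ (k : ℤ) : ℝ :=
  ∫ β in (-π)..π, ∫ s in (0 : ℝ)..1,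
    β * Real.sin (β * s) / (4 * Real.sin (β / 2) ^ 2) *
      Real.cos (((k : ℝ) - 1) * (s - 1) * β - β)


lemma sinc_ne_zero_aux {x : ℝ} (hx : x ∈ Set.Icc (-(π/2)) (π/2)) : Real.sinc x ≠ 0 := by
  have hpi := Real.pi_pos
  by_cases h : x = 0
  · simp [h]
  · rw [Real.sinc_of_ne_zero h]
    refine div_ne_zero ?_ h
    intro h0
    exact h ((Real.sin_eq_zero_iff_of_lt_of_lt (by linarith [hx.1]) (by linarith [hx.2])).1 h0)

lemma cont_aux : ContinuousOn (fun x : ℝ => Real.cos x / Real.sinc x) (Set.Icc (-(π/2)) (π/2)) :=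
  Real.continuous_cos.continuousOn.div Real.continuous_sinc.continuousOn
    (fun _ hx => sinc_ne_zero_aux hx)

lemma int_aux : IntervalIntegrable (fun x : ℝ => Real.cos x / Real.sinc x)
    MeasureTheory.volume (-(π/2)) (π/2) := by
  apply ContinuousOn.intervalIntegrable
  rw [Set.uIcc_of_le (by linarith [Real.pi_pos])]
  exact cont_aux

lemma log_sin_aux : ∫ x in (-(π/2))..(π/2), Real.log (Real.sin x) = - Real.log 2 * π := by
  rw [← intervalIntegral.integral_add_adjacent_intervals (b := 0)
    (by exact intervalIntegrable_log_sin) (by exact intervalIntegrable_log_sin)]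
  have h := intervalIntegral.integral_comp_neg (a := 0) (b := π/2)
    (fun x => Real.log (Real.sin x))
  simp only [Real.sin_neg, Real.log_neg_eq_log, neg_zero] at h
  rw [← h, integral_log_sin_zero_pi_div_two]
  ring

lemma key_aux : ∫ x in (-(π/2))..(π/2), Real.cos x / Real.sinc x = Real.log 2 * π := by
  have hpi := Real.pi_pos
  have h := MeasureTheory.integral_eq_of_hasDerivAt_off_countable_of_le
    (fun x : ℝ => x * Real.log (Real.sin x))
    (fun x : ℝ => Real.log (Real.sin x) + Real.cos x / Real.sinc x)
    (a := -(π/2)) (b := π/2) (by linarith) (s := {0}) (Set.countable_singleton 0) ?_ ?_ ?_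
  · rw [intervalIntegral.integral_add (by exact intervalIntegrable_log_sin) int_aux,
      log_sin_aux] at h
    simp at h
    linarith
  · have : Set.EqOn (fun x : ℝ => x * Real.log (Real.sin x))
        (fun x : ℝ => x * Real.log (Real.sinc x) + x * Real.log x) (Set.Icc (-(π/2)) (π/2)) := by
      intro x hx
      by_cases h : x = 0
      · simp [h]
      · have h1 : Real.sin x = Real.sinc x * x := by
          rw [Real.sinc_of_ne_zero h]; field_simp
        simp only
        rw [h1, Real.log_mul (sinc_ne_zero_aux hx) h]; ring
    refine ContinuousOn.congr ?_ this
    refine ContinuousOn.add ?_ Real.continuous_mul_log.continuousOn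
    exact continuousOn_id.mul (Real.continuous_sinc.continuousOn.log
      (fun _ hx => sinc_ne_zero_aux hx))
  · rintro x ⟨hx, hx0⟩
    have hx0 : x ≠ 0 := hx0
    have hs : Real.sin x ≠ 0 := fun h0 =>
      hx0 ((Real.sin_eq_zero_iff_of_lt_of_lt (by linarith [hx.1]) (by linarith [hx.2])).1 h0)
    have := (hasDerivAt_id x).mul ((Real.hasDerivAt_sin x).log hs)
    refine HasDerivAt.congr_deriv this ?_
    rw [Real.sinc_of_ne_zero hx0]
    simp only [id]
    field_simp
  · exact IntervalIntegrable.add (by exact intervalIntegrable_log_sin) int_aux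

lemma key2_aux : ∫ β in (-π)..π, Real.cos (β/2) / Real.sinc (β/2) = 2 * Real.log 2 * π := by
  rw [intervalIntegral.integral_comp_div (fun x => Real.cos x / Real.sinc x) two_ne_zero,
    neg_div, key_aux]
  simp; ring

lemma int2_aux : IntervalIntegrable (fun β : ℝ => Real.cos (β/2) / Real.sinc (β/2))
    MeasureTheory.volume (-π) π := by
  apply ContinuousOn.intervalIntegrable
  rw [Set.uIcc_of_le (by linarith [Real.pi_pos])]
  refine cont_aux.comp (f := fun β : ℝ => β/2) (by fun_prop) ?_
  intro x hx
  constructor <;> linarith [hx.1, hx.2]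

lemma cos_sq_aux : ∫ β in (-π)..π, Real.cos (β/2) ^ 2 = π := by
  rw [intervalIntegral.integral_comp_div (fun x => Real.cos x ^ 2) two_ne_zero, integral_cos_sq]
  simp [neg_div]
  ring

lemma mul_sin_aux : ∫ β in (-π)..π, β * Real.sin β = 2 * π := by
  have h : ∀ x ∈ Set.uIcc (-π) π,
      HasDerivAt (fun x : ℝ => Real.sin x - x * Real.cos x) (x * Real.sin x) x := by
    intro x _
    have := (Real.hasDerivAt_sin x).sub ((hasDerivAt_id x).mul (Real.hasDerivAt_cos x))
    refine HasDerivAt.congr_deriv this ?_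
    simp only [id]
    ring
  rw [intervalIntegral.integral_eq_sub_of_hasDerivAt h
    ((by fun_prop : Continuous fun x : ℝ => x * Real.sin x).intervalIntegrable _ _)]
  simp; ring

lemma inner_aux (c d β : ℝ) (hβ : β ≠ 0) :
    ∫ s in (0:ℝ)..1, c * (Real.sin (2 * β * s - 2 * β) + d)
      = c * (-(1 - Real.cos (2 * β)) / (2 * β) + d) := by
  have h : ∀ x ∈ Set.uIcc (0:ℝ) 1,
      HasDerivAt (fun s : ℝ => c * (-Real.cos (2 * β * s - 2 * β) / (2 * β) + d * s))
        (c * (Real.sin (2 * β * x - 2 * β) + d)) x := by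
    intro x _
    have h0 : HasDerivAt (fun s : ℝ => 2 * β * s - 2 * β) (2 * β) x := by
      simpa using ((hasDerivAt_id x).const_mul (2 * β)).sub_const (2 * β)
    have := (((h0.cos.neg.div_const (2 * β)).add ((hasDerivAt_id x).const_mul d)).const_mul c)
    refine HasDerivAt.congr_deriv this ?_
    field_simp
  rw [intervalIntegral.integral_eq_sub_of_hasDerivAt h
    ((by fun_prop : Continuous fun x : ℝ => c * (Real.sin (2 * β * x - 2 * β) + d)).intervalIntegrable _ _)]
  simp
  ring

lemma trig_aux (ε β : ℝ) (hβ : β ≠ 0) (hm : β ∈ Set.Icc (-π) π) :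
    β / (8 * Real.sin (β/2) ^ 2) * (-(1 - Real.cos (2 * β)) / (2 * β) + ε * Real.sin (2 * β))
     = - (Real.cos (β/2) ^ 2) / 2 + ε * (Real.cos (β/2) / Real.sinc (β/2) - β * Real.sin β / 2) := by
  have hb2 : β/2 ≠ 0 := by simpa using hβ
  have hs : Real.sin (β/2) ≠ 0 := by
    have := sinc_ne_zero_aux (x := β/2) ⟨by linarith [hm.1], by linarith [hm.2]⟩
    rw [Real.sinc_of_ne_zero hb2] at this
    exact fun h => this (by simp [h])
  rw [Real.sinc_of_ne_zero hb2]
  obtain ⟨x, rfl⟩ : ∃ x, β = 2 * x := ⟨β/2, by ring⟩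
  have hx : x ≠ 0 := by simpa using hβ
  have e : 2 * x / 2 = x := by ring
  rw [e] at hs ⊢
  rw [Real.cos_two_mul (2 * x), Real.sin_two_mul (2 * x), Real.sin_two_mul x, Real.cos_two_mul x]
  have h2 := Real.sin_sq_add_cos_sq x
  have h3 : Real.cos x ^ 2 = 1 - Real.sin x ^ 2 := by linarith
  field_simp
  have h4 : Real.cos x ^ 4 = (1 - Real.sin x ^ 2) ^ 2 := by rw [← h3]; ring
  ring_nf
  simp only [h4, h3, show Real.cos x ^ 3 = Real.cos x * (1 - Real.sin x ^ 2) by rw [← h3]; ring]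
  ring

lemma outer_aux (ε : ℝ) (f : ℝ → ℝ → ℝ) (hf : ∀ β s, f β s =
    β / (8 * Real.sin (β/2) ^ 2) * (Real.sin (2 * β * s - 2 * β) + ε * Real.sin (2 * β))) :
    ∫ β in (-π)..π, ∫ s in (0:ℝ)..1, f β s = - π / 2 + ε * (2 * Real.log 2 * π - π) := by
  have : ∫ β in (-π)..π, ∫ s in (0:ℝ)..1, f β s = ∫ β in (-π)..π,
      ((-1/2) * (Real.cos (β/2) ^ 2)
        + ε * (Real.cos (β/2) / Real.sinc (β/2) - (1/2) * (β * Real.sin β))) := by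
    apply intervalIntegral.integral_congr_ae
    filter_upwards [MeasureTheory.Measure.ae_ne MeasureTheory.volume (0:ℝ)] with β hβ hm
    rw [Set.uIoc_of_le (by linarith [Real.pi_pos])] at hm
    simp only [hf]
    rw [inner_aux _ _ _ hβ, trig_aux ε β hβ ⟨hm.1.le, hm.2⟩]
    ring
  have hc : IntervalIntegrable (fun β : ℝ => (-1/2) * (Real.cos (β/2) ^ 2))
      MeasureTheory.volume (-π) π := Continuous.intervalIntegrable (by fun_prop) _ _
  have hd : IntervalIntegrable (fun β : ℝ => (1/2) * (β * Real.sin β))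
      MeasureTheory.volume (-π) π := Continuous.intervalIntegrable (by fun_prop) _ _
  rw [this, intervalIntegral.integral_add hc ((int2_aux.sub hd).const_mul ε),
    intervalIntegral.integral_const_mul, intervalIntegral.integral_const_mul,
    intervalIntegral.integral_sub int2_aux hd, intervalIntegral.integral_const_mul,
    cos_sq_aux, key2_aux, mul_sin_aux]
  ring

/-- `I₁(2) = π(1/2 − log 4)` and `I₂(2) = π(log 4 − 3/2)`. -/
theorem stmt5 : I₁ 2 = π * (1 / 2 - Real.log 4) ∧ I₂ 2 = π * (Real.log 4 - 3 / 2) := by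
  have h4 : Real.log 4 = 2 * Real.log 2 := by
    rw [show (4:ℝ) = 2 ^ 2 by norm_num, Real.log_pow]; norm_num
  have e1 : ∀ β s : ℝ, 2 * (Real.cos (β * s) * Real.sin (((2:ℝ) - 1) * (s - 1) * β - β))
      = Real.sin (2 * β * s - 2 * β) + (-1) * Real.sin (2 * β) := by
    intro β s
    rw [show ((2:ℝ) - 1) * (s - 1) * β - β = β * s - 2 * β by ring,
      show 2 * β * s - 2 * β = β * s + (β * s - 2 * β) by ring,
      show Real.sin (2 * β) = Real.sin (β * s - (β * s - 2 * β)) by congr 1; ring,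
      Real.sin_add, Real.sin_sub (β * s) (β * s - 2 * β)]
    ring
  have e2 : ∀ β s : ℝ, 2 * (Real.sin (β * s) * Real.cos (((2:ℝ) - 1) * (s - 1) * β - β))
      = Real.sin (2 * β * s - 2 * β) + 1 * Real.sin (2 * β) := by
    intro β s
    rw [show ((2:ℝ) - 1) * (s - 1) * β - β = β * s - 2 * β by ring,
      show 2 * β * s - 2 * β = β * s + (β * s - 2 * β) by ring,
      show Real.sin (2 * β) = Real.sin (β * s - (β * s - 2 * β)) by congr 1; ring,
      Real.sin_add, Real.sin_sub (β * s) (β * s - 2 * β)]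
    ring
  constructor
  · unfold I₁
    rw [outer_aux (-1) _ (fun β s => ?_), h4]
    · ring
    · rw [← e1]; push_cast; ring
  · unfold I₂
    rw [outer_aux 1 _ (fun β s => ?_), h4]
    · ring
    · rw [← e2]; push_cast; ring
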